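/- Let n ≥ 3 and let ρ : so(1,2) → so(1,n−1) be an injective homomorphism of real Lie algebras. Then there exists g ∈ SO(1,n−1) such that the composition of ρ with conjugation by g, i.e. A ↦ g ρ(A) g⁻¹, equals the standard diagonal embedding of so(1,2) into so(1,n−1). -/

import Mathlib

open Matrix

attribute [local instance 100] LieRing.ofAssociativeRing

/-- The diagonal matrix `J_{1,m-1} = diag(-1, 1, …, 1)` of the standard Lorentzian
quadratic form of signature `(1, m-1)` on `ℝ^m`. -/
noncomputable def minkMatrix (m : ℕ) : Matrix (Fin m) (Fin m) ℝ :=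
  Matrix.diagonal (fun i => if (i : ℕ) = 0 then (-1 : ℝ) else 1)

/-- The Lie algebra `so(1, m-1)` of real `m × m` matrices `A` with
`Aᵀ J + J A = 0` for `J = diag(-1, 1, …, 1)`. -/
noncomputable def soOneM (m : ℕ) : LieSubalgebra ℝ (Matrix (Fin m) (Fin m) ℝ) :=
  skewAdjointMatricesLieSubalgebra (minkMatrix m)

/-- The standard diagonal embedding of `3 × 3` matrices into `n × n` matrices:
`A` goes to the block matrix with `A` in the top-left `3 × 3` block and `0` elsewhere. -/
noncomputable def diagEmbed (n : ℕ) (A : Matrix (Fin 3) (Fin 3) ℝ) :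
    Matrix (Fin n) (Fin n) ℝ := fun i j =>
  if hi : (i : ℕ) < 3 then
    if hj : (j : ℕ) < 3 then A ⟨i, hi⟩ ⟨j, hj⟩ else 0
  else 0

section core
variable {V : Type*} [AddCommGroup V] [Module ℝ V]

theorem nilp_aux [FiniteDimensional ℝ V] (h e : Module.End ℝ V) (c : ℝ) (hc : c ≠ 0)
    (hhe : h * e - e * h = c • e) : ∃ k, e ^ k = 0 := by
  by_contra! hne
  have key : ∀ k : ℕ, h * e ^ k - e ^ k * h = (k * c : ℝ) • e ^ k := by
    intro k
    induction k with
    | zero => simp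
    | succ k ih =>
      have h1 : h * e = e * h + c • e := by rw [← hhe]; abel
      have h2 : h * e ^ k = e ^ k * h + (k * c : ℝ) • e ^ k := by rw [← ih]; abel
      rw [pow_succ, ← mul_assoc, h2, add_mul, mul_assoc, h1, mul_add]
      simp only [smul_mul_assoc, mul_smul_comm, mul_assoc, Nat.cast_succ, add_mul, add_smul, one_mul]
      abel
  let D : Module.End ℝ (Module.End ℝ V) := LinearMap.mulLeft ℝ h - LinearMap.mulRight ℝ h
  have hev : ∀ k : ℕ, D.HasEigenvalue (k * c : ℝ) := by
    intro k
    apply Module.End.hasEigenvalue_of_hasEigenvector (x := e ^ k)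
    refine ⟨?_, hne k⟩
    rw [Module.End.mem_eigenspace_iff]
    simpa [D] using key k
  have hfin : Set.Finite {μ : ℝ | D.HasEigenvalue μ} := Module.End.finite_hasEigenvalue D
  have hinj : Function.Injective (fun k : ℕ => (k * c : ℝ)) := by
    intro a b hab
    have := mul_right_cancel₀ hc hab
    exact_mod_cast this
  exact Set.infinite_of_injective_forall_mem hinj hev hfin

theorem odd_aux (B : LinearMap.BilinForm ℝ V) (hs : ∀ x y, B x y = B y x)
    (hN : ∀ x y, B x x ≤ 0 → B y y ≤ 0 → B x y = 0 → x ≠ 0 → ∃ c : ℝ, y = c • x)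
    (hnd : ∀ x, (∀ y, B x y = 0) → x = 0) (S : Module.End ℝ V)
    (hS : ∀ x y, B (S x) y = - B x (S y)) (h0 : ∀ x y, B (S x) (S y) = 0) : S = 0 := by
  ext x
  by_contra hx
  have hx : S x ≠ 0 := hx
  have : ∃ y, B (S x) y ≠ 0 := by
    by_contra! hy
    exact hx (hnd _ hy)
  obtain ⟨y, hy⟩ := this
  obtain ⟨c, hc⟩ := hN (S x) (S y) (h0 _ _).le (h0 _ _).le (h0 _ _) hx
  have h1 : B (S y) y = 0 := by
    have := hS y y
    rw [hs y (S y)] at this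
    linarith
  rw [hc] at h1
  simp only [map_smul, LinearMap.smul_apply, smul_eq_mul] at h1
  have hc0 : c = 0 := by
    rcases mul_eq_zero.1 h1 with h | h
    · exact h
    · exact absurd h hy
  apply hy
  rw [hS, hc, hc0]; simp

theorem cube_aux (B : LinearMap.BilinForm ℝ V) (hs : ∀ x y, B x y = B y x)
    (hN : ∀ x y, B x x ≤ 0 → B y y ≤ 0 → B x y = 0 → x ≠ 0 → ∃ c : ℝ, y = c • x)
    (hnd : ∀ x, (∀ y, B x y = 0) → x = 0) (e : Module.End ℝ V)
    (hS : ∀ x y, B (e x) y = - B x (e y)) (hnil : ∃ k, e ^ k = 0) (he : e ≠ 0) :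
    (∀ x, e (e (e x)) = 0) ∧ (∃ x, e (e x) ≠ 0) ∧
    (∀ x, e (e x) ≠ 0 → ∀ y, ∃ c : ℝ, e (e y) = c • e (e x)) := by
  have hpow : ∀ (k : ℕ) x y, B ((e ^ k) x) y = (-1) ^ k * B x ((e ^ k) y) := by
    intro k
    induction k with
    | zero => simp
    | succ k ih =>
      intro x y
      rw [pow_succ, Module.End.mul_apply, ih, hS, ← Module.End.mul_apply, ← pow_succ', pow_succ e k]
      ring
  have hiso : ∀ j : ℕ, e ^ (2 * j) = 0 → ∀ x y, B ((e ^ j) x) ((e ^ j) y) = 0 := by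
    intro j hj x y
    rw [hpow, ← Module.End.mul_apply, ← pow_add, ← two_mul, hj]
    simp
  have hodd : ∀ j : ℕ, Odd j → e ^ (2 * j) = 0 → e ^ j = 0 := by
    intro j hj h2
    refine odd_aux B hs hN hnd _ ?_ (hiso j h2)
    intro x y
    rw [hpow, hj.neg_one_pow]; ring
  classical
  let m := Nat.find hnil
  have hm : e ^ m = 0 := Nat.find_spec hnil
  have hlt : ∀ k, k < m → e ^ k ≠ 0 := fun k hk => Nat.find_min hnil hk
  have hge : ∀ k, m ≤ k → e ^ k = 0 := fun k hk => pow_eq_zero_of_le hk hm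
  have hV : e ^ 0 ≠ 0 := by
    intro h
    apply he
    have : e = e ^ 0 * e := by simp
    rw [this, h, zero_mul]
  have hm2 : 2 ≤ m := by
    by_contra hlt2
    have := hge 1 (by omega)
    simp at this
    exact he this
  have hm3 : m = 3 := by
    rcases Nat.even_or_odd m with hev | ho
    · exfalso
      obtain ⟨r, hr⟩ := hev
      exact hlt (m - 1) (by omega) (hodd (m - 1) ⟨r - 1, by omega⟩ (hge _ (by omega)))
    · by_contra h3
      obtain ⟨r, hr⟩ := ho
      exact hlt (m - 2) (by omega) (hodd (m - 2) ⟨r - 1, by omega⟩ (hge _ (by omega)))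
  rw [hm3] at hm hlt hge
  have h2 : e ^ 2 ≠ 0 := hlt 2 (by norm_num)
  have e2 : ∀ x, (e ^ 2) x = e (e x) := fun x => by rw [pow_two]; rfl
  refine ⟨fun x => ?_, ?_, ?_⟩
  · have := congrArg (fun g : Module.End ℝ V => g x) hm
    simpa [pow_succ] using this
  · by_contra! hc
    apply h2
    ext x
    rw [e2, hc]; rfl
  · intro x hx y
    have h4 := hiso 2 (hge _ (by norm_num))
    simp only [e2] at h4
    exact hN _ _ (h4 _ _).le (h4 _ _).le (h4 _ _) hx

theorem core_aux [FiniteDimensional ℝ V] (B : LinearMap.BilinForm ℝ V)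
    (hs : ∀ x y, B x y = B y x)
    (hN : ∀ x y, B x x ≤ 0 → B y y ≤ 0 → B x y = 0 → x ≠ 0 → ∃ c : ℝ, y = c • x)
    (hnd : ∀ x, (∀ y, B x y = 0) → x = 0) (e f h : Module.End ℝ V)
    (se : ∀ x y, B (e x) y = - B x (e y))
    (sf : ∀ x y, B (f x) y = - B x (f y))
    (he : h * e - e * h = e) (hf : h * f - f * h = - f) (hef : e * f - f * e = (2 : ℝ) • h)
    (e0 : e ≠ 0) (f0 : f ≠ 0) (sh : ∀ x y, B (h x) y = - B x (h y)) :
    ∃ p w q : V, e p = 0 ∧ e w = (2 : ℝ) • p ∧ e q = (2 : ℝ) • w ∧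
      h p = p ∧ h w = 0 ∧ h q = - q ∧ f p = w ∧ f w = q ∧ f q = 0 ∧
      B p p = 0 ∧ B p w = 0 ∧ B p q = -4 ∧ B w w = 4 ∧ B w q = 0 ∧ B q q = 0 ∧
      ∀ u, B u p = 0 → B u w = 0 → B u q = 0 → e u = 0 ∧ f u = 0 ∧ h u = 0 := by
  obtain ⟨e3, ⟨x0, hx0⟩, e2⟩ := cube_aux B hs hN hnd e se
    (nilp_aux h e 1 one_ne_zero (by simpa using he)) e0
  obtain ⟨f3, -, f2⟩ := cube_aux B hs hN hnd f sf
    (nilp_aux h f (-1) (by norm_num) (by simpa using hf)) f0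
  have he' : ∀ x, h (e x) = e (h x) + e x := fun x => by
    have := congrArg (fun g : Module.End ℝ V => g x) he
    simp only [LinearMap.sub_apply, Module.End.mul_apply] at this
    rw [← sub_eq_iff_eq_add']; exact this
  have hf' : ∀ x, h (f x) = f (h x) - f x := fun x => by
    have := congrArg (fun g : Module.End ℝ V => g x) hf
    simp only [LinearMap.sub_apply, LinearMap.neg_apply, Module.End.mul_apply] at this
    rw [sub_eq_add_neg, ← sub_eq_iff_eq_add']; exact this
  have hef' : ∀ x, e (f x) = f (e x) + (2 : ℝ) • h x := fun x => by
    have := congrArg (fun g : Module.End ℝ V => g x) hef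
    simp only [LinearMap.sub_apply, LinearMap.smul_apply, Module.End.mul_apply] at this
    rw [← sub_eq_iff_eq_add']; exact this
  -- the highest weight vector
  obtain ⟨p, hp⟩ : ∃ p, p = e (e x0) := ⟨_, rfl⟩
  have p0 : p ≠ 0 := hp ▸ hx0
  have ep : e p = 0 := by rw [hp]; exact e3 _
  have e2p : ∀ y, ∃ c : ℝ, e (e y) = c • p := hp ▸ e2 x0 hx0
  have hee : ∀ y, h (e (e y)) = e (e (h y)) + (2 : ℝ) • e (e y) := fun y => by
    rw [he', he', map_add, two_smul]; abel
  have hpp : B p p = 0 := by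
    nth_rw 1 [hp]; rw [se, ep]; simp
  obtain ⟨l, hl⟩ : ∃ l : ℝ, h p = l • p := by
    obtain ⟨c, hc⟩ := e2p (h x0)
    exact ⟨c + 2, by rw [add_smul, ← hc, hp, hee]⟩
  have hl1 : l = 1 := by
    obtain ⟨y, hy⟩ : ∃ y, B p y ≠ 0 := by
      by_contra! hy
      exact p0 (hnd _ hy)
    obtain ⟨a, ha⟩ := e2p x0
    -- `e (e y) ≠ 0`
    obtain ⟨c, hc⟩ := e2p y
    have hsym : ∀ u v, B (e (e u)) v = B u (e (e v)) := fun u v => by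
      rw [se, se, neg_neg]
    have hc0 : c ≠ 0 := by
      rintro rfl
      apply hy
      rw [hp, hsym, hc]; simp
    have h1 := hee y
    have h2 : B (h (e (e y))) y = B (e (e (h y))) y + 2 * B (e (e y)) y := by
      rw [h1]; simp
    rw [hsym (h y), sh y, hc, map_smul, hl, hs y] at h2
    simp only [map_smul, LinearMap.smul_apply, smul_eq_mul] at h2
    have h3 : c * (B p y) * (l - 1) = 0 := by linarith
    have h4 := (mul_eq_zero.1 h3).resolve_left (mul_ne_zero hc0 hy)
    linarith
  subst hl1
  rw [one_smul] at hl
  clear hee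
  have hwp : 0 < B (f p) (f p) := by
    by_contra! hle
    have h1 : B p (f p) = 0 := by
      have := sf p p
      rw [hs (f p)] at this
      linarith
    obtain ⟨c, hc⟩ := hN p (f p) hpp.le hle h1 p0
    have h2 : e (f p) = (2 : ℝ) • p := by rw [hef', ep, hl]; simp
    rw [hc, map_smul, ep, smul_zero] at h2
    exact p0 ((smul_eq_zero.1 h2.symm).resolve_left (by norm_num))
  obtain ⟨p', p0', ep', e2p', hpp', hl', hw'⟩ : ∃ p' : V, p' ≠ 0 ∧ e p' = 0 ∧
      (∀ y, ∃ c : ℝ, e (e y) = c • p') ∧ B p' p' = 0 ∧ h p' = p' ∧ B (f p') (f p') = 4 := by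
    have hsq := Real.sqrt_pos.2 hwp
    have hsq2 := Real.mul_self_sqrt hwp.le
    set r := Real.sqrt (B (f p) (f p)) with hr
    refine ⟨(2 / r) • p, smul_ne_zero (by positivity) p0, ?_, ?_, ?_, ?_, ?_⟩
    · rw [map_smul, ep, smul_zero]
    · intro y
      obtain ⟨c, hc⟩ := e2p y
      refine ⟨c * (r / 2), ?_⟩
      rw [hc, smul_smul]
      congr 1
      field_simp
    · simp [hpp]
    · rw [map_smul, hl]
    · simp only [map_smul, LinearMap.smul_apply, smul_eq_mul]
      rw [← hsq2]; field_simp; norm_num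
  clear hwp hl hpp e2p ep p0 hp p
  have self0 : ∀ x, B x (f x) = 0 := fun x => by
    have := sf x x
    rw [hs (f x)] at this
    linarith
  have hw : h (f p') = 0 := by rw [hf', hl']; simp
  have pq : B p' (f (f p')) = -4 := by
    have := sf p' (f p')
    linarith
  have q0 : f (f p') ≠ 0 := by
    intro hq
    rw [hq] at pq
    simp at pq
  refine ⟨p', f p', f (f p'), ep', ?_, ?_, hl', hw, ?_, rfl, rfl, f3 _, hpp', self0 _, pq, hw',
    self0 _, ?_, ?_⟩
  · rw [hef', ep', hl']; simp
  · rw [hef', hw, hef', ep', hl']; simp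
  · rw [hf', hw]; simp
  · rw [sf, f3]; simp
  · intro u up uw uq
    -- timelike vector
    have pos : ∀ z, B z p' = 0 → B z (f (f p')) = 0 → B z z = 0 → z = 0 := by
      intro z z1 z2 z3
      obtain ⟨c, hc⟩ := hN p' z hpp'.le z3.le (by rw [hs]; exact z1) p0'
      rw [hc] at z2
      simp only [map_smul, LinearMap.smul_apply, smul_eq_mul, pq] at z2
      have : c = 0 := by linarith
      rw [hc, this, zero_smul]
    have eu : e u = 0 := by
      apply pos
      · rw [se, ep']; simp
      · rw [se, hef', hw, hef', ep', hl']; simp [uw]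
      · obtain ⟨c, hc⟩ := e2p' u
        rw [se, hc]; simp [up]
    have fu : f u = 0 := by
      apply pos
      · rw [sf, uw]; simp
      · rw [sf, f3]; simp
      · obtain ⟨c, hc⟩ := f2 p' q0 u
        rw [sf, hc]; simp [uq]
    refine ⟨eu, fu, ?_⟩
    have := hef' u
    rw [eu, fu] at this
    simpa using this.symm
end core
section conc

noncomputable def mB (m : ℕ) : LinearMap.BilinForm ℝ (Fin (m + 3) → ℝ) :=
  Matrix.toBilin' (minkMatrix (m + 3))

theorem mB_apply (m : ℕ) (x y : Fin (m + 3) → ℝ) :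
    mB m x y = - (x 0 * y 0) + ∑ i : Fin (m + 2), x i.succ * y i.succ := by
  rw [mB, Matrix.toBilin'_apply', minkMatrix, dotProduct, Fin.sum_univ_succ]
  simp [Matrix.mulVec_diagonal]

theorem mB_symm (m : ℕ) (x y : Fin (m + 3) → ℝ) : mB m x y = mB m y x := by
  rw [mB_apply, mB_apply]
  simp only [mul_comm]

theorem mB_zero (m : ℕ) (x : Fin (m + 3) → ℝ) (h0 : x 0 = 0) (hx : mB m x x ≤ 0) : x = 0 := by
  rw [mB_apply, h0] at hx
  simp only [mul_zero, neg_zero, zero_add] at hx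
  have hnn : ∀ i ∈ Finset.univ, (0 : ℝ) ≤ x (Fin.succ i) * x (Fin.succ i) :=
    fun i _ => mul_self_nonneg _
  have h1 := (Finset.sum_eq_zero_iff_of_nonneg hnn).1 (le_antisymm hx (Finset.sum_nonneg hnn))
  ext i
  refine Fin.cases h0 (fun j => ?_) i
  exact mul_self_eq_zero.1 (h1 j (Finset.mem_univ _))

theorem mB_N (m : ℕ) (x y : Fin (m + 3) → ℝ) (hx : mB m x x ≤ 0) (hy : mB m y y ≤ 0)
    (hxy : mB m x y = 0) (x0 : x ≠ 0) : ∃ c : ℝ, y = c • x := by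
  have hx0 : x 0 ≠ 0 := fun h => x0 (mB_zero m x h hx)
  have hz : y 0 • x - x 0 • y = 0 := by
    apply mB_zero
    · simp [mul_comm]
    · simp only [map_sub, map_smul, LinearMap.sub_apply, LinearMap.smul_apply, smul_eq_mul, hxy,
        mB_symm m y x]
      nlinarith [mul_nonneg (sq_nonneg (y 0)) (neg_nonneg.2 hx),
        mul_nonneg (sq_nonneg (x 0)) (neg_nonneg.2 hy)]
  refine ⟨y 0 / x 0, ?_⟩
  rw [sub_eq_zero] at hz
  rw [div_eq_inv_mul, mul_smul, hz, smul_smul, inv_mul_cancel₀ hx0, one_smul]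

theorem mB_nd (m : ℕ) (x : Fin (m + 3) → ℝ) (h : ∀ y, mB m x y = 0) : x = 0 := by
  ext i
  have := h (Pi.single i 1)
  rw [mB, Matrix.toBilin'_apply', minkMatrix] at this
  simp only [mulVec_single_one, dotProduct, Matrix.col_apply, Matrix.diagonal_apply] at this
  simp only [mul_ite, mul_neg, mul_one, mul_zero, Finset.sum_ite_eq', Finset.mem_univ, if_true] at this
  split_ifs at this <;> simpa using this

theorem mB_skew (m : ℕ) (A : Matrix (Fin (m + 3)) (Fin (m + 3)) ℝ) (hA : A ∈ soOneM (m + 3))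
    (x y : Fin (m + 3) → ℝ) : mB m (Matrix.toLin' A x) y = - mB m x (Matrix.toLin' A y) := by
  have h : Aᵀ * minkMatrix (m + 3) = minkMatrix (m + 3) * (-A) := by
    simpa [soOneM, Matrix.IsSkewAdjoint, Matrix.IsAdjointPair] using hA
  rw [mB, Matrix.toBilin'_apply', Matrix.toBilin'_apply', toLin'_apply, toLin'_apply,
    ← Matrix.vecMul_transpose, ← Matrix.dotProduct_mulVec, Matrix.mulVec_mulVec, h,
    ← Matrix.mulVec_mulVec, Matrix.neg_mulVec, Matrix.mulVec_neg, dotProduct_neg]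

theorem extend_aux (m : ℕ) (v0 v1 v2 : Fin (m + 3) → ℝ)
    (h00 : mB m v0 v0 = -1) (h11 : mB m v1 v1 = 1) (h22 : mB m v2 v2 = 1)
    (h01 : mB m v0 v1 = 0) (h02 : mB m v0 v2 = 0) (h12 : mB m v1 v2 = 0) (k : ℕ) (hk : k ≤ m) :
    ∃ v : ℕ → Fin (m + 3) → ℝ, v 0 = v0 ∧ v 1 = v1 ∧ v 2 = v2 ∧
      ∀ i j, i < k + 3 → j < k + 3 →
        mB m (v i) (v j) = if i = j then (if i = 0 then -1 else 1) else 0 := by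
  induction k with
  | zero =>
    refine ⟨fun i => if i = 0 then v0 else if i = 1 then v1 else v2, rfl, rfl, rfl, ?_⟩
    intro i j hi hj
    have h10 := (mB_symm m v1 v0).trans h01
    have h20 := (mB_symm m v2 v0).trans h02
    have h21 := (mB_symm m v2 v1).trans h12
    interval_cases i <;> interval_cases j <;> simp [*]
  | succ k ih =>
    obtain ⟨v, a0, a1, a2, hv⟩ := ih (by omega)
    let T : (Fin (m + 3) → ℝ) →ₗ[ℝ] (Fin (k + 3) → ℝ) := LinearMap.pi (fun i => mB m (v i))
    have hT : LinearMap.ker T ≠ ⊥ := by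
      apply LinearMap.ker_ne_bot_of_finrank_lt
      simp; omega
    obtain ⟨u, hu, u0⟩ := (Submodule.ne_bot_iff _).1 hT
    have hu' : ∀ i, i < k + 3 → mB m (v i) u = 0 := fun i hi =>
      congrFun (LinearMap.mem_ker.1 hu) ⟨i, hi⟩
    have hpos : 0 < mB m u u := by
      by_contra! hle
      have hv0 : mB m (v 0) (v 0) = -1 := by rw [a0, h00]
      have hne : v 0 ≠ 0 := by
        intro h; rw [h] at hv0; simp at hv0
      obtain ⟨c, hc⟩ := mB_N m (v 0) u (by rw [hv0]; norm_num) hle (hu' 0 (by omega)) hne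
      have := hu' 0 (by omega)
      rw [hc, map_smul, hv0] at this
      have hc0 : c = 0 := by simpa using this
      rw [hc0, zero_smul] at hc
      exact u0 hc
    have hsq := Real.sqrt_pos.2 hpos
    have hsq2 := Real.mul_self_sqrt hpos.le
    set r := Real.sqrt (mB m u u) with hr
    have hself : mB m (r⁻¹ • u) (r⁻¹ • u) = 1 := by
      simp only [map_smul, LinearMap.smul_apply, smul_eq_mul]
      rw [← hsq2]; field_simp
    have hoth : ∀ i, i < k + 3 → mB m (v i) (r⁻¹ • u) = 0 := fun i hi => by
      rw [map_smul, hu' i hi, smul_zero]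
    refine ⟨Function.update v (k + 3) (r⁻¹ • u), ?_, ?_, ?_, ?_⟩
    · rw [Function.update_of_ne (by omega), a0]
    · rw [Function.update_of_ne (by omega), a1]
    · rw [Function.update_of_ne (by omega), a2]
    · intro i j hi hj
      by_cases hik : i = k + 3
      · by_cases hjk : j = k + 3
        · subst hik; subst hjk
          rw [Function.update_self, hself]; simp
        · rw [hik, Function.update_self, Function.update_of_ne hjk, mB_symm, hoth j (by omega),
            if_neg (Ne.symm hjk)]
      · by_cases hjk : j = k + 3
        · rw [hjk, Function.update_self, Function.update_of_ne hik, hoth i (by omega), if_neg hik]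
        · rw [Function.update_of_ne hik, Function.update_of_ne hjk, hv i j (by omega) (by omega)]

noncomputable def sH : Matrix (Fin 3) (Fin 3) ℝ := !![0, 1, 0; 1, 0, 0; 0, 0, 0]
noncomputable def sE : Matrix (Fin 3) (Fin 3) ℝ := !![0, 0, 1; 0, 0, 1; 1, -1, 0]
noncomputable def sF : Matrix (Fin 3) (Fin 3) ℝ := !![0, 0, 1; 0, 0, -1; 1, 1, 0]

theorem mem_so3 (A : Matrix (Fin 3) (Fin 3) ℝ) :
    A ∈ soOneM 3 ↔ ∀ i j, (Aᵀ * minkMatrix 3) i j = (minkMatrix 3 * (-A)) i j := by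
  rw [Matrix.ext_iff]
  simp [soOneM, Matrix.IsSkewAdjoint, Matrix.IsAdjointPair]

theorem sH_mem : sH ∈ soOneM 3 := by
  rw [mem_so3]; intro i j
  fin_cases i <;> fin_cases j <;> simp [sH, minkMatrix]

theorem sE_mem : sE ∈ soOneM 3 := by
  rw [mem_so3]; intro i j
  fin_cases i <;> fin_cases j <;> simp [sE, minkMatrix]

theorem sF_mem : sF ∈ soOneM 3 := by
  rw [mem_so3]; intro i j
  fin_cases i <;> fin_cases j <;> simp [sF, minkMatrix]

theorem so3_decomp (A : soOneM 3) : ∃ a b c : ℝ,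
    A = a • (⟨sH, sH_mem⟩ : soOneM 3) + b • (⟨sE, sE_mem⟩ : soOneM 3)
      + c • (⟨sF, sF_mem⟩ : soOneM 3) := by
  obtain ⟨A, hA⟩ := A
  have h := (mem_so3 A).1 hA
  refine ⟨A 0 1, (A 0 2 + A 1 2) / 2, (A 0 2 - A 1 2) / 2, ?_⟩
  apply Subtype.ext
  change A = A 0 1 • sH + ((A 0 2 + A 1 2) / 2) • sE + ((A 0 2 - A 1 2) / 2) • sF
  have h00 := h 0 0
  have h01 := h 0 1
  have h02 := h 0 2
  have h11 := h 1 1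
  have h12 := h 1 2
  have h22 := h 2 2
  simp [minkMatrix] at h00 h01 h02 h11 h12 h22
  ext i j
  fin_cases i <;> fin_cases j <;> simp [sH, sE, sF] <;> linarith

theorem br_HE : ⁅(⟨sH, sH_mem⟩ : soOneM 3), (⟨sE, sE_mem⟩ : soOneM 3)⁆ = ⟨sE, sE_mem⟩ := by
  apply Subtype.ext
  rw [LieSubalgebra.coe_bracket, Ring.lie_def]
  ext i j
  fin_cases i <;> fin_cases j <;> simp [sH, sE]

theorem br_HF : ⁅(⟨sH, sH_mem⟩ : soOneM 3), (⟨sF, sF_mem⟩ : soOneM 3)⁆ = -⟨sF, sF_mem⟩ := by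
  apply Subtype.ext
  rw [LieSubalgebra.coe_bracket, Ring.lie_def]
  ext i j
  fin_cases i <;> fin_cases j <;> simp [sH, sF]

theorem br_EF : ⁅(⟨sE, sE_mem⟩ : soOneM 3), (⟨sF, sF_mem⟩ : soOneM 3)⁆
    = (2 : ℝ) • ⟨sH, sH_mem⟩ := by
  apply Subtype.ext
  rw [LieSubalgebra.coe_bracket, Ring.lie_def]
  ext i j
  fin_cases i <;> fin_cases j <;> simp [sH, sE, sF] <;> norm_num

theorem sE_ne : (⟨sE, sE_mem⟩ : soOneM 3) ≠ 0 := by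
  intro h
  have := congrFun (congrFun (congrArg Subtype.val h) 0) 2
  simp [sE] at this

theorem sF_ne : (⟨sF, sF_mem⟩ : soOneM 3) ≠ 0 := by
  intro h
  have := congrFun (congrFun (congrArg Subtype.val h) 0) 2
  simp [sF] at this

end conc
section final

theorem inter_aux (m : ℕ) (v : ℕ → Fin (m + 3) → ℝ) (M : Matrix (Fin (m + 3)) (Fin (m + 3)) ℝ)
    (S : Matrix (Fin 3) (Fin 3) ℝ)
    (h : ∀ j : Fin 3, M *ᵥ v j = S 0 j • v 0 + S 1 j • v 1 + S 2 j • v 2)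
    (h' : ∀ j, 3 ≤ j → j < m + 3 → M *ᵥ v j = 0) :
    M * (Matrix.of fun i j : Fin (m + 3) => v j i)
      = (Matrix.of fun i j : Fin (m + 3) => v j i) * diagEmbed (m + 3) S := by
  ext i j
  have hl : (M * (Matrix.of fun i j : Fin (m + 3) => v j i)) i j = (M *ᵥ v j) i := rfl
  rw [hl, Matrix.mul_apply, Fin.sum_univ_succ, Fin.sum_univ_succ, Fin.sum_univ_succ]
  by_cases hj : (j : ℕ) < 3
  · have := congrFun (h ⟨j, hj⟩) i
    simp only at this
    rw [this]
    have h2 : 2 % (m + 3) = 2 := Nat.mod_eq_of_lt (by omega)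
    have h3 : ∀ x : ℕ, ¬ (x + 1 + 1 + 1 < 3) := fun x => by omega
    simp [diagEmbed, hj, h2, h3]
    ring
  · rw [h' j (by omega) j.2]
    simp [diagEmbed, hj]

theorem diagEmbed_lin (n : ℕ) (a b c : ℝ) (X Y Z : Matrix (Fin 3) (Fin 3) ℝ) :
    diagEmbed n (a • X + b • Y + c • Z)
      = a • diagEmbed n X + b • diagEmbed n Y + c • diagEmbed n Z := by
  ext i j
  by_cases hi : (i : ℕ) < 3 <;> by_cases hj : (j : ℕ) < 3 <;> simp [diagEmbed, hi, hj]

theorem flip_aux (m : ℕ) : ∃ D : Matrix (Fin (m + 3)) (Fin (m + 3)) ℝ, D.det = -1 ∧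
    Dᵀ * minkMatrix (m + 3) * D = minkMatrix (m + 3) ∧
    ∀ S, diagEmbed (m + 3) S * D = D * diagEmbed (m + 3) S := by
  refine ⟨Matrix.diagonal (fun i => if (i : ℕ) < 3 then -1 else 1), ?_, ?_, ?_⟩
  · rw [Matrix.det_diagonal, Fin.prod_univ_succ, Fin.prod_univ_succ, Fin.prod_univ_succ]
    have h2 : 2 % (m + 3) = 2 := Nat.mod_eq_of_lt (by omega)
    have h3 : ∀ x : ℕ, ¬ (x + 1 + 1 + 1 < 3) := fun x => by omega
    simp [h2, h3]
  · rw [minkMatrix, Matrix.diagonal_transpose, Matrix.diagonal_mul_diagonal,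
      Matrix.diagonal_mul_diagonal]
    congr 1
    ext i
    split_ifs <;> norm_num
  · intro S
    ext i j
    rw [Matrix.mul_diagonal, Matrix.diagonal_mul]
    by_cases hi : (i : ℕ) < 3 <;> by_cases hj : (j : ℕ) < 3 <;> simp [diagEmbed, hi, hj]

end final

/-- Any injective Lie algebra morphism `so(1,2) → so(1,n-1)`, `n ≥ 3`, is conjugate by an
element of `SO(1,n-1)` to the standard diagonal embedding. -/
theorem so12_embedding_conjugate_to_diagonal (n : ℕ) (hn : 3 ≤ n)
    (ρ : soOneM 3 →ₗ⁅ℝ⁆ soOneM n) (hρ : Function.Injective ρ) :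
    ∃ g : Matrix (Fin n) (Fin n) ℝ,
      gᵀ * minkMatrix n * g = minkMatrix n ∧ g.det = 1 ∧
      ∀ A : soOneM 3,
        g * ((ρ A : Matrix (Fin n) (Fin n) ℝ)) * g⁻¹
          = diagEmbed n (A : Matrix (Fin 3) (Fin 3) ℝ) := by
  obtain ⟨m, rfl⟩ : ∃ m, n = m + 3 := ⟨n - 3, by omega⟩
  set H : soOneM 3 := ⟨sH, sH_mem⟩ with hH
  set E : soOneM 3 := ⟨sE, sE_mem⟩ with hE
  set F : soOneM 3 := ⟨sF, sF_mem⟩ with hF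
  have lie : ∀ X Y : soOneM 3, Matrix.toLin' (ρ X).1 * Matrix.toLin' (ρ Y).1
      - Matrix.toLin' (ρ Y).1 * Matrix.toLin' (ρ X).1 = Matrix.toLin' (ρ ⁅X, Y⁆).1 := by
    intro X Y
    rw [LieHom.map_lie, LieSubalgebra.coe_bracket, Ring.lie_def, map_sub, Matrix.toLin'_mul,
      Matrix.toLin'_mul]
    rfl
  have ne : ∀ X : soOneM 3, X ≠ 0 → Matrix.toLin' (ρ X).1 ≠ 0 := by
    intro X hX h0
    apply hX
    apply hρ
    rw [map_zero]
    apply Subtype.ext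
    exact (LinearEquiv.map_eq_zero_iff _).1 h0
  obtain ⟨p, w, q, ep, ew, eq, hp, hw, hq, fp, fw, fq, pp, pw, pq, ww, wq, qq, hu⟩ :=
    core_aux (mB m) (mB_symm m) (mB_N m) (mB_nd m)
      (Matrix.toLin' (ρ E).1) (Matrix.toLin' (ρ F).1) (Matrix.toLin' (ρ H).1)
      (mB_skew m _ (ρ E).2) (mB_skew m _ (ρ F).2)
      (by rw [lie, br_HE]) (by rw [lie, br_HF, map_neg]; exact map_neg (Matrix.toLin') _)
      (by rw [lie, br_EF, map_smul]; exact map_smul (Matrix.toLin') _ _)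
      (ne E sE_ne) (ne F sF_ne) (mB_skew m _ (ρ H).2)
  have wp := (mB_symm m w p).trans pw
  have qp := (mB_symm m q p).trans pq
  have qw := (mB_symm m q w).trans wq
  obtain ⟨v, v0, v1, v2, hv⟩ := extend_aux m ((1 / 2 : ℝ) • p + (1 / 4 : ℝ) • q)
    ((1 / 2 : ℝ) • p - (1 / 4 : ℝ) • q) ((1 / 2 : ℝ) • w)
    (by simp [*]; norm_num) (by simp [*]; norm_num) (by simp [*]; norm_num)
    (by simp [*]; norm_num) (by simp [*]) (by simp [*]) m le_rfl
  have hperp : ∀ j, 3 ≤ j → j < m + 3 → Matrix.toLin' (ρ E).1 (v j) = 0 ∧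
      Matrix.toLin' (ρ F).1 (v j) = 0 ∧ Matrix.toLin' (ρ H).1 (v j) = 0 := by
    intro j hj3 hjm
    have h0 := hv j 0 hjm (by omega)
    have h1 := hv j 1 hjm (by omega)
    have h2 := hv j 2 hjm (by omega)
    rw [if_neg (by omega)] at h0 h1 h2
    rw [v0] at h0
    rw [v1] at h1
    rw [v2] at h2
    simp only [map_add, map_sub, map_smul, smul_eq_mul] at h0 h1 h2
    exact hu _ (by linarith) (by linarith) (by linarith)
  simp only [Matrix.toLin'_apply] at ep ew eq hp hw hq fp fw fq hperp
  set G : Matrix (Fin (m + 3)) (Fin (m + 3)) ℝ := Matrix.of fun i j => v j i with hG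
  have iH : (ρ H).1 * G = G * diagEmbed (m + 3) sH := by
    apply inter_aux
    · intro j
      fin_cases j <;>
        simp [v0, v1, v2, sH, Matrix.mulVec_add, Matrix.mulVec_sub, Matrix.mulVec_smul, hp, hw, hq]
      module
    · exact fun j h1 h2 => (hperp j h1 h2).2.2
  have iE : (ρ E).1 * G = G * diagEmbed (m + 3) sE := by
    apply inter_aux
    · intro j
      fin_cases j <;>
        simp [v0, v1, v2, sE, Matrix.mulVec_add, Matrix.mulVec_sub, Matrix.mulVec_smul, ep, ew, eq]
        <;> module
    · exact fun j h1 h2 => (hperp j h1 h2).1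
  have iF : (ρ F).1 * G = G * diagEmbed (m + 3) sF := by
    apply inter_aux
    · intro j
      fin_cases j <;>
        simp [v0, v1, v2, sF, Matrix.mulVec_add, Matrix.mulVec_sub, Matrix.mulVec_smul, fp, fw, fq]
        <;> module
    · exact fun j h1 h2 => (hperp j h1 h2).2.1
  have iA : ∀ A : soOneM 3, (ρ A).1 * G = G * diagEmbed (m + 3) A.1 := by
    intro A
    obtain ⟨a, b, c, rfl⟩ := so3_decomp A
    have h1 : (ρ (a • H + b • E + c • F)).1 = a • (ρ H).1 + b • (ρ E).1 + c • (ρ F).1 := by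
      rw [map_add, map_add, map_smul, map_smul, map_smul]; rfl
    have h2 : (a • H + b • E + c • F).1 = a • sH + b • sE + c • sF := rfl
    rw [h1, h2, diagEmbed_lin]
    simp only [add_mul, mul_add, smul_mul_assoc, mul_smul_comm, iH, iE, iF]
  have hGJ : Gᵀ * minkMatrix (m + 3) * G = minkMatrix (m + 3) := by
    ext i j
    have h1 : (Gᵀ * minkMatrix (m + 3) * G) i j = mB m (v i) (v j) := by
      rw [mB, Matrix.toBilin'_apply', Matrix.mul_assoc]
      rfl
    rw [h1, hv i j i.2 j.2, minkMatrix, Matrix.diagonal_apply]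
    simp only [Fin.ext_iff]
  have hJdet : (minkMatrix (m + 3)).det ≠ 0 := by
    rw [minkMatrix, Matrix.det_diagonal, Finset.prod_ne_zero_iff]
    intro i _
    split_ifs <;> norm_num
  have hdet : G.det = 1 ∨ G.det = -1 := by
    have := congrArg Matrix.det hGJ
    rw [Matrix.det_mul, Matrix.det_mul, Matrix.det_transpose] at this
    apply mul_self_eq_one_iff.1
    apply mul_right_cancel₀ hJdet
    linarith
  obtain ⟨K, hK1, hKJ, hKA⟩ : ∃ K : Matrix (Fin (m + 3)) (Fin (m + 3)) ℝ, K.det = 1 ∧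
      Kᵀ * minkMatrix (m + 3) * K = minkMatrix (m + 3) ∧
      ∀ A : soOneM 3, (ρ A).1 * K = K * diagEmbed (m + 3) A.1 := by
    rcases hdet with h | h
    · exact ⟨G, h, hGJ, iA⟩
    · obtain ⟨D, hD, hDJ, hDA⟩ := flip_aux m
      refine ⟨G * D, by rw [Matrix.det_mul, h, hD]; norm_num, ?_, fun A => ?_⟩
      · calc (G * D)ᵀ * minkMatrix (m + 3) * (G * D)
            = Dᵀ * (Gᵀ * minkMatrix (m + 3) * G) * D := by
              rw [Matrix.transpose_mul]; simp only [Matrix.mul_assoc]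
          _ = _ := by rw [hGJ, hDJ]
      · rw [← Matrix.mul_assoc, iA, Matrix.mul_assoc, hDA, Matrix.mul_assoc]
  have hunit : IsUnit K.det := by rw [hK1]; exact isUnit_one
  have hKK : K * K⁻¹ = 1 := Matrix.mul_nonsing_inv K hunit
  have hKK' : K⁻¹ * K = 1 := Matrix.nonsing_inv_mul K hunit
  refine ⟨K⁻¹, ?_, ?_, ?_⟩
  · calc (K⁻¹)ᵀ * minkMatrix (m + 3) * K⁻¹
        = (K⁻¹)ᵀ * (Kᵀ * minkMatrix (m + 3) * K) * K⁻¹ := by rw [hKJ]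
      _ = (K * K⁻¹)ᵀ * minkMatrix (m + 3) * (K * K⁻¹) := by
        rw [Matrix.transpose_mul]; simp only [Matrix.mul_assoc]
      _ = _ := by rw [hKK]; simp
  · rw [Matrix.det_nonsing_inv, hK1]; simp
  · intro A
    rw [Matrix.nonsing_inv_nonsing_inv K hunit, Matrix.mul_assoc, hKA, ← Matrix.mul_assoc, hKK',
      Matrix.one_mul]
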